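/- arXiv:2007.15964 — 11 statements merged into one kernel-verified Lean document; each statement's English description precedes it below -/
import Mathlib

section
/- Let B > 0, let n ≥ 3 be a natural number, and let C be a real constant with C ≤ (n−2)²/(12B). Set D = (n−2)² − 12BC (so D ≥ 0), r₀ = √((n−2+√D)/(6B)) and A = ((1−2n+√D)/3)·r₀⁴. Then r₀ > 0, and the function u(r) = 1 + C/r² + A/r⁴ + B·r² satisfies u(r₀) = 0 and 1 − A/r₀⁴ + 2B·r₀² = n. -/
/-- algebraic core of Theorem 3.1. With D = (n−2)² − 12BC,
r₀ = √((n−2+√D)/(6B)) and A = ((1−2n+√D)/3)·r₀⁴, one has r₀ > 0,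
u(r₀) = 0 and 1 − A/r₀⁴ + 2B·r₀² = n. -/
theorem eguchi_hanson_typeI_closing_conditions (B : ℝ) (hB : 0 < B)
    (n : ℕ) (hn : 3 ≤ n) (C : ℝ) (hC : C ≤ ((n : ℝ) - 2) ^ 2 / (12 * B)) :
    let D : ℝ := ((n : ℝ) - 2) ^ 2 - 12 * B * C
    let r₀ : ℝ := Real.sqrt (((n : ℝ) - 2 + Real.sqrt D) / (6 * B))
    let A : ℝ := ((1 - 2 * (n : ℝ) + Real.sqrt D) / 3) * r₀ ^ 4
    0 < r₀ ∧
      1 + C / r₀ ^ 2 + A / r₀ ^ 4 + B * r₀ ^ 2 = 0 ∧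
      1 - A / r₀ ^ 4 + 2 * B * r₀ ^ 2 = (n : ℝ) := by
  intro D r₀ A
  have hn' : (3 : ℝ) ≤ n := by exact_mod_cast hn
  have hD : 0 ≤ D := by
    have h := (le_div_iff₀ (by positivity)).mp hC
    simp only [D]
    linarith
  have hsq : Real.sqrt D ^ 2 = ((n : ℝ) - 2) ^ 2 - 12 * B * C := Real.sq_sqrt hD
  have hnum : 0 < (n : ℝ) - 2 + Real.sqrt D := by linarith [Real.sqrt_nonneg D]
  have hx : 0 < ((n : ℝ) - 2 + Real.sqrt D) / (6 * B) := by positivity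
  have hr : 0 < r₀ := Real.sqrt_pos.mpr hx
  have hr2 : r₀ ^ 2 = ((n : ℝ) - 2 + Real.sqrt D) / (6 * B) := Real.sq_sqrt hx.le
  have hA : A / r₀ ^ 4 = (1 - 2 * (n : ℝ) + Real.sqrt D) / 3 :=
    mul_div_cancel_right₀ _ (by positivity)
  have hB2 : B * r₀ ^ 2 = ((n : ℝ) - 2 + Real.sqrt D) / 6 := by
    rw [hr2]
    field_simp
  have hC2 : C / r₀ ^ 2 = ((n : ℝ) - 2 - Real.sqrt D) / 2 := by
    rw [hr2, div_eq_iff hx.ne']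
    field_simp
    linarith
  refine ⟨hr, ?_, ?_⟩
  · rw [hA, hB2, hC2]
    ring
  · rw [hA, mul_assoc, hB2]
    ring
end

section
/- Let B > 0, let n ≥ 3 be a natural number, and let C be a real constant with C ≤ (n−2)²/(12B). Set D = (n−2)² − 12BC, r₀ = √((n−2+√D)/(6B)) and A = ((1−2n+√D)/3)·r₀⁴. Then for every r > r₀ one has 1 + C/r² + A/r⁴ + B·r² > 0; that is, r₀ is the largest positive zero of u(r) = 1 + C/r² + A/r⁴ + Br². -/
/-- With D = (n−2)² − 12BC, r₀ = √((n−2+√D)/(6B)) and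
A = ((1−2n+√D)/3)·r₀⁴, the function u(r) = 1 + C/r² + A/r⁴ + B·r² is
positive for all r > r₀; i.e. r₀ is the largest positive zero of u. -/
theorem eguchi_hanson_typeI_largest_root (B : ℝ) (hB : 0 < B)
    (n : ℕ) (hn : 3 ≤ n) (C : ℝ) (hC : C ≤ ((n : ℝ) - 2) ^ 2 / (12 * B)) :
    let D : ℝ := ((n : ℝ) - 2) ^ 2 - 12 * B * C
    let r₀ : ℝ := Real.sqrt (((n : ℝ) - 2 + Real.sqrt D) / (6 * B))
    let A : ℝ := ((1 - 2 * (n : ℝ) + Real.sqrt D) / 3) * r₀ ^ 4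
    ∀ r : ℝ, r₀ < r → 0 < 1 + C / r ^ 2 + A / r ^ 4 + B * r ^ 2 := by
  intro D r₀ A r hr
  have hn' : (3 : ℝ) ≤ n := by exact_mod_cast hn
  have hD : 0 ≤ D := by
    have := (le_div_iff₀ (by positivity : (0 : ℝ) < 12 * B)).1 hC
    simp only [D]
    linarith
  have hqD : Real.sqrt D ^ 2 = ((n : ℝ) - 2) ^ 2 - 12 * B * C := Real.sq_sqrt hD
  have hq : 0 ≤ Real.sqrt D := Real.sqrt_nonneg D
  have hnum : 0 < (n : ℝ) - 2 + Real.sqrt D := by linarith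
  have hs : r₀ ^ 2 = ((n : ℝ) - 2 + Real.sqrt D) / (6 * B) := Real.sq_sqrt (by positivity)
  have hA : A = ((1 - 2 * (n : ℝ) + Real.sqrt D) / 3) * (r₀ ^ 2) ^ 2 := by
    simp only [A]
    ring
  have hr₀ : 0 ≤ r₀ := Real.sqrt_nonneg _
  have hrpos : 0 < r := hr₀.trans_lt hr
  have ht : 0 < r ^ 2 - r₀ ^ 2 := sub_pos.2 (pow_lt_pow_left₀ hr hr₀ two_ne_zero)
  have hspos : 0 < r₀ ^ 2 := by
    rw [hs]
    positivity
  generalize r₀ ^ 2 = s at *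
  generalize Real.sqrt D = q at *
  have hq' : q = 6 * B * s - (n - 2) := by
    rw [hs]
    field_simp
    ring
  have hC' : C = s * (n - 2) - 3 * B * s ^ 2 := by
    apply mul_left_cancel₀ (by positivity : 12 * B ≠ 0)
    rw [hq'] at hqD
    linear_combination hqD
  have key : 1 + C / r ^ 2 + A / r ^ 4 + B * r ^ 2 =
      (r ^ 2 - s) * (B * (r ^ 2 - s) ^ 2 + (3 * B * s + 1) * (r ^ 2 - s) + s * n) / r ^ 4 := by
    rw [hA, hC', hq']
    field_simp
    ring
  rw [key]
  positivity
end

section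
/- Let B > 0 and A, C be real constants, let (a, b) ⊆ (0, ∞) be a nonempty open interval on which u(r) = 1 + C/r² + A/r⁴ + B·r² > 0, and let v : (a, b) → ℝ be twice differentiable. Suppose that for all r ∈ (a, b): (1 + C/r² + A/r⁴ + Br²)·v''(r) = (1/r + C/r³ + A/r⁵ + Br)·v'(r) and (−C/r³ − 2A/r⁵ + Br)·v'(r) = (4C/r⁴)·v(r). Then v is constant on (a, b) and C·v(r) = 0 for all r ∈ (a, b). -/
open Set

lemma eq_of_hasDerivAt_zero_Ioo {f : ℝ → ℝ} {a b : ℝ}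
    (hf : ∀ x ∈ Ioo a b, HasDerivAt f 0 x) {x y : ℝ} (hx : x ∈ Ioo a b) (hy : y ∈ Ioo a b) :
    f x = f y :=
  isOpen_Ioo.is_const_of_deriv_eq_zero isPreconnected_Ioo
    (fun z hz => (hf z hz).differentiableAt.differentiableWithinAt)
    (fun z hz => (hf z hz).deriv) hx hy

/-- A function with `r * v'' = v'` on an interval of positive reals is affine in `r ^ 2`. -/
lemma exists_eq_add_sq_of_mul_deriv_deriv_eq {v : ℝ → ℝ} {a b : ℝ} (ha : 0 < a) (hab : a < b)
    (hv1 : ∀ r ∈ Ioo a b, DifferentiableAt ℝ v r)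
    (hv2 : ∀ r ∈ Ioo a b, DifferentiableAt ℝ (deriv v) r)
    (h : ∀ r ∈ Ioo a b, r * deriv (deriv v) r = deriv v r) :
    ∃ k m : ℝ, ∀ r ∈ Ioo a b, deriv v r = 2 * k * r ∧ v r = k * r ^ 2 + m := by
  obtain ⟨c, hc⟩ := nonempty_Ioo.2 hab
  have hpos : ∀ r ∈ Ioo a b, r ≠ 0 := fun r hr => (ha.trans hr.1).ne'
  have hquot : ∀ r ∈ Ioo a b, HasDerivAt (fun x => deriv v x / x) 0 r := fun r hr => by
    refine HasDerivAt.congr_deriv ((hv2 r hr).hasDerivAt.div (hasDerivAt_id' r) (hpos r hr)) ?_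
    rw [← h r hr]
    ring
  obtain ⟨k, hk⟩ : ∃ k, deriv v c / c = 2 * k := ⟨deriv v c / c / 2, by ring⟩
  have hderiv : ∀ r ∈ Ioo a b, deriv v r = 2 * k * r := fun r hr => by
    rw [← hk, ← eq_of_hasDerivAt_zero_Ioo hquot hr hc, div_mul_cancel₀ _ (hpos r hr)]
  have hdiff : ∀ r ∈ Ioo a b, HasDerivAt (fun x => v x - k * x ^ 2) 0 r := fun r hr => by
    refine HasDerivAt.congr_deriv ((hv1 r hr).hasDerivAt.sub ((hasDerivAt_pow 2 r).const_mul k)) ?_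
    rw [hderiv r hr]
    push_cast
    ring
  refine ⟨k, v c - k * c ^ 2, fun r hr => ⟨hderiv r hr, ?_⟩⟩
  linarith [eq_of_hasDerivAt_zero_Ioo hdiff hr hc]

open Polynomial in
lemma leadingCoeff_eq_zero_of_sextic_eq_zero_on_Ioo {a b p q s : ℝ} (hab : a < b)
    (h : ∀ r ∈ Ioo a b, p * r ^ 6 + q * r ^ 2 + s = 0) : p = 0 := by
  have hzero : (C p * X ^ 6 + C q * X ^ 2 + C s : ℝ[X]) = 0 :=
    Polynomial.eq_zero_of_infinite_isRoot _
      ((Ioo_infinite hab).mono fun r hr => by simpa using h r hr)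
  simpa [coeff_X_pow, coeff_C] using congrArg (fun f : ℝ[X] => f.coeff 6) hzero

/-- analytic core of Theorem 3.2. If v satisfies the two ODEs
(1 + C/r² + A/r⁴ + Br²)·v'' = (1/r + C/r³ + A/r⁵ + Br)·v' and
(−C/r³ − 2A/r⁵ + Br)·v' = (4C/r⁴)·v on a nonempty open interval (a,b) ⊆ (0,∞)
where 1 + C/r² + A/r⁴ + Br² > 0, then v is constant and C·v = 0 there. -/
theorem eguchi_hanson_typeI_no_static_development (B A C : ℝ) (hB : 0 < B)
    (a b : ℝ) (ha : 0 < a) (hab : a < b)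
    (hupos : ∀ r ∈ Ioo a b, 0 < 1 + C / r ^ 2 + A / r ^ 4 + B * r ^ 2)
    (v : ℝ → ℝ)
    (hv1 : ∀ r ∈ Ioo a b, DifferentiableAt ℝ v r)
    (hv2 : ∀ r ∈ Ioo a b, DifferentiableAt ℝ (deriv v) r)
    (hode1 : ∀ r ∈ Ioo a b,
      (1 + C / r ^ 2 + A / r ^ 4 + B * r ^ 2) * deriv (deriv v) r
        = (1 / r + C / r ^ 3 + A / r ^ 5 + B * r) * deriv v r)
    (hode2 : ∀ r ∈ Ioo a b,
      (-C / r ^ 3 - 2 * A / r ^ 5 + B * r) * deriv v r = (4 * C / r ^ 4) * v r) :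
    (∀ r ∈ Ioo a b, ∀ s ∈ Ioo a b, v r = v s) ∧ (∀ r ∈ Ioo a b, C * v r = 0) := by
  have hpos : ∀ r ∈ Ioo a b, r ≠ 0 := fun r hr => (ha.trans hr.1).ne'
  have heuler : ∀ r ∈ Ioo a b, r * deriv (deriv v) r = deriv v r := fun r hr => by
    have hr0 := hpos r hr
    apply mul_left_cancel₀ (hupos r hr).ne'
    rw [mul_left_comm, hode1 r hr]
    field_simp
  obtain ⟨k, m, hkm⟩ := exists_eq_add_sq_of_mul_deriv_deriv_eq ha hab hv1 hv2 heuler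
  have hsextic : ∀ r ∈ Ioo a b,
      2 * k * B * r ^ 6 + (-6 * C * k) * r ^ 2 + (-4 * A * k - 4 * C * m) = 0 := fun r hr => by
    have hr0 := hpos r hr
    have h := hode2 r hr
    rw [(hkm r hr).1, (hkm r hr).2] at h
    field_simp at h
    linarith
  have hk : k = 0 := by
    simpa [hB.ne'] using leadingCoeff_eq_zero_of_sextic_eq_zero_on_Ioo hab hsextic
  subst hk
  refine ⟨fun r hr s hs => by rw [(hkm r hr).2, (hkm s hs).2]; ring, fun r hr => ?_⟩
  have h := hsextic r hr
  rw [(hkm r hr).2]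
  linarith
end

section
/- Let B, A, C be real constants. The function u(r) = 1 + (C·√(1+Br²))/r⁴ + A/r⁴ satisfies, for every r > 0 with 1 + Br² > 0, the ordinary differential equation (1+Br²)·u''(r) + (7/r + 8Br)·u'(r) + (8/r² + 12B)·u(r) − 8/r² = 12B. -/
theorem hasDerivAt_sqrt_one_add_mul_sq {B s : ℝ} (h : 0 < 1 + B * s ^ 2) :
    HasDerivAt (fun t : ℝ => √(1 + B * t ^ 2)) (B * s / √(1 + B * s ^ 2)) s := by
  have h' := ((((hasDerivAt_id s).pow 2).const_mul B).const_add 1).sqrt h.ne'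
  refine h'.congr_deriv ?_
  simp only [id_eq, Pi.pow_apply]
  field_simp
  simp

theorem hasDerivAt_one_add_sqrt_div_pow_four {B s : ℝ} (A C : ℝ) (hs : s ≠ 0)
    (h : 0 < 1 + B * s ^ 2) :
    HasDerivAt (fun t : ℝ => 1 + C * √(1 + B * t ^ 2) / t ^ 4 + A / t ^ 4)
      (C * B / (√(1 + B * s ^ 2) * s ^ 3) - 4 * C * √(1 + B * s ^ 2) / s ^ 5 - 4 * A / s ^ 5) s := by
  have hS : √(1 + B * s ^ 2) ≠ 0 := (Real.sqrt_pos.2 h).ne'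
  have h' := ((((hasDerivAt_sqrt_one_add_mul_sq h).const_mul C).fun_div
    (hasDerivAt_pow 4 s) (pow_ne_zero 4 hs)).const_add 1).fun_add
    ((hasDerivAt_const s A).fun_div (hasDerivAt_pow 4 s) (pow_ne_zero 4 hs))
  refine h'.congr_deriv ?_
  generalize √(1 + B * s ^ 2) = S at hS ⊢
  push_cast
  field_simp
  ring

theorem hasDerivAt_deriv_one_add_sqrt_div_pow_four {B s : ℝ} (A C : ℝ) (hs : s ≠ 0)
    (h : 0 < 1 + B * s ^ 2) :
    HasDerivAt (fun t : ℝ => C * B / (√(1 + B * t ^ 2) * t ^ 3) -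
        4 * C * √(1 + B * t ^ 2) / t ^ 5 - 4 * A / t ^ 5)
      (-(C * B ^ 2) / (√(1 + B * s ^ 2) ^ 3 * s ^ 2) - 7 * C * B / (√(1 + B * s ^ 2) * s ^ 4) +
        20 * C * √(1 + B * s ^ 2) / s ^ 6 + 20 * A / s ^ 6) s := by
  have hS : √(1 + B * s ^ 2) ≠ 0 := (Real.sqrt_pos.2 h).ne'
  have hsqrt := hasDerivAt_sqrt_one_add_mul_sq h
  have h' := (((hasDerivAt_const s (C * B)).fun_div (hsqrt.fun_mul (hasDerivAt_pow 3 s))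
    (mul_ne_zero hS (pow_ne_zero 3 hs))).fun_sub
    ((hsqrt.const_mul (4 * C)).fun_div (hasDerivAt_pow 5 s) (pow_ne_zero 5 hs))).fun_sub
    ((hasDerivAt_const s (4 * A)).fun_div (hasDerivAt_pow 5 s) (pow_ne_zero 5 hs))
  refine h'.congr_deriv ?_
  generalize √(1 + B * s ^ 2) = S at hS ⊢
  push_cast
  field_simp
  ring


/-- The function u(r) = 1 + C·√(1+Br²)/r⁴ + A/r⁴ satisfies the ODE
(1+Br²)·u'' + (7/r + 8Br)·u' + (8/r² + 12B)·u − 8/r² = 12B for every r > 0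
with 1 + Br² > 0. -/
theorem eguchi_hanson_typeII_scalar_curvature_ode (B A C : ℝ) :
    ∀ r : ℝ, 0 < r → 0 < 1 + B * r ^ 2 →
      (1 + B * r ^ 2) *
          deriv (deriv (fun s : ℝ =>
            1 + C * Real.sqrt (1 + B * s ^ 2) / s ^ 4 + A / s ^ 4)) r
        + (7 / r + 8 * B * r) *
          deriv (fun s : ℝ =>
            1 + C * Real.sqrt (1 + B * s ^ 2) / s ^ 4 + A / s ^ 4) r
        + (8 / r ^ 2 + 12 * B) *
          (1 + C * Real.sqrt (1 + B * r ^ 2) / r ^ 4 + A / r ^ 4)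
        - 8 / r ^ 2
      = 12 * B := by
  intro r hr h
  have hcont : Continuous fun s : ℝ => 1 + B * s ^ 2 := by fun_prop
  have hderiv : deriv (fun s : ℝ => 1 + C * √(1 + B * s ^ 2) / s ^ 4 + A / s ^ 4) =ᶠ[nhds r]
      fun s => C * B / (√(1 + B * s ^ 2) * s ^ 3) -
        4 * C * √(1 + B * s ^ 2) / s ^ 5 - 4 * A / s ^ 5 := by
    filter_upwards [eventually_ne_nhds hr.ne', hcont.continuousAt.eventually (lt_mem_nhds h)]
      with s hs hpos
    exact (hasDerivAt_one_add_sqrt_div_pow_four A C hs hpos).deriv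
  rw [hderiv.deriv_eq, hderiv.eq_of_nhds,
    (hasDerivAt_deriv_one_add_sqrt_div_pow_four A C hr.ne' h).deriv]
  have hS : √(1 + B * r ^ 2) ≠ 0 := (Real.sqrt_pos.2 h).ne'
  have hsq : √(1 + B * r ^ 2) ^ 2 = 1 + B * r ^ 2 := Real.sq_sqrt h.le
  generalize √(1 + B * r ^ 2) = S at hS hsq ⊢
  obtain rfl : B = (S ^ 2 - 1) / r ^ 2 := by
    rw [eq_div_iff (pow_ne_zero 2 hr.ne')]
    linarith
  field_simp
  ring
end

section
/- Let B > 0, let n be a real number, let A, C be real constants, and let r₀ > 0 satisfy 1 + (C·√(1+Br₀²))/r₀⁴ + A/r₀⁴ = 0 and √(1+Br₀²)·(1 − A/r₀⁴) − C/r₀⁴ − BC/(2r₀²) = n. Then s₀ = r₀² satisfies the cubic equation s₀³ + ((4−n²)/(4B))·s₀² + (nC/4)·s₀ − BC²/16 = 0. -/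
/-- If r₀ > 0 satisfies 1 + C·√(1+Br₀²)/r₀⁴ + A/r₀⁴ = 0 and
√(1+Br₀²)·(1 − A/r₀⁴) − C/r₀⁴ − BC/(2r₀²) = n, then s₀ = r₀² satisfies
s₀³ + ((4−n²)/(4B))·s₀² + (nC/4)·s₀ − BC²/16 = 0. -/
theorem eguchi_hanson_typeII_cubic (B : ℝ) (hB : 0 < B) (n : ℝ) (A C : ℝ)
    (r₀ : ℝ) (hr₀ : 0 < r₀)
    (hroot : 1 + C * Real.sqrt (1 + B * r₀ ^ 2) / r₀ ^ 4 + A / r₀ ^ 4 = 0)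
    (hn : Real.sqrt (1 + B * r₀ ^ 2) * (1 - A / r₀ ^ 4)
        - C / r₀ ^ 4 - B * C / (2 * r₀ ^ 2) = n) :
    (r₀ ^ 2) ^ 3 + ((4 - n ^ 2) / (4 * B)) * (r₀ ^ 2) ^ 2
      + (n * C / 4) * (r₀ ^ 2) - B * C ^ 2 / 16 = 0 := by
  have hs : 0 < r₀ ^ 2 := by positivity
  have hw : Real.sqrt (1 + B * r₀ ^ 2) ^ 2 = 1 + B * r₀ ^ 2 := Real.sq_sqrt (by positivity)
  rw [show r₀ ^ 4 = (r₀ ^ 2) ^ 2 by ring] at hroot hn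
  generalize Real.sqrt (1 + B * r₀ ^ 2) = w at *
  generalize r₀ ^ 2 = s at *
  have hA : A = -s ^ 2 - C * w := by
    field_simp at hroot
    linarith
  have hlin : 2 * w * s = n * s - B * C / 2 := by
    rw [← hn, hA]
    field_simp
    linear_combination -2 * C * hw
  field_simp
  linear_combination 16 * (2 * w * s + n * s - B * C / 2) * hlin - 64 * s ^ 2 * hw
end

section
/- Let B > 0, let n ≥ 3 be a natural number, and let C be a real constant. Define Δ = (27B⁴C⁴ − 2B²C³·n(n²−36) − 4(n²−4)²C²)/(27648B²), C₁ = (n³ − 36n − (n²+12)√(n²+12))/(27B²), and C₂ = (n³ − 36n + (n²+12)√(n²+12))/(27B²). If C < C₁ or C > C₂, then Δ > 0. -/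
/-- claim (i) of Theorem 4.2. If C < C₁ or C > C₂, then the
Cardano discriminant Δ = (27B⁴C⁴ − 2B²C³n(n²−36) − 4(n²−4)²C²)/(27648B²)
is positive. -/
theorem eguchi_hanson_typeII_discriminant_positive (B : ℝ) (hB : 0 < B)
    (n : ℕ) (hn : 3 ≤ n) (C : ℝ) :
    let Δ : ℝ := (27 * B ^ 4 * C ^ 4
        - 2 * B ^ 2 * C ^ 3 * (n : ℝ) * ((n : ℝ) ^ 2 - 36)
        - 4 * ((n : ℝ) ^ 2 - 4) ^ 2 * C ^ 2) / (27648 * B ^ 2)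
    let C₁ : ℝ := ((n : ℝ) ^ 3 - 36 * (n : ℝ)
        - ((n : ℝ) ^ 2 + 12) * Real.sqrt ((n : ℝ) ^ 2 + 12)) / (27 * B ^ 2)
    let C₂ : ℝ := ((n : ℝ) ^ 3 - 36 * (n : ℝ)
        + ((n : ℝ) ^ 2 + 12) * Real.sqrt ((n : ℝ) ^ 2 + 12)) / (27 * B ^ 2)
    C < C₁ ∨ C₂ < C → 0 < Δ := by
  intro Δ C₁ C₂ h
  have hB2 : 0 < 27 * B ^ 2 := by positivity
  have hs : Real.sqrt ((n : ℝ) ^ 2 + 12) ^ 2 = (n : ℝ) ^ 2 + 12 := Real.sq_sqrt (by positivity)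
  have hs0 : 0 ≤ ((n : ℝ) ^ 2 + 12) * Real.sqrt ((n : ℝ) ^ 2 + 12) := by positivity
  have hlt : ((n : ℝ) ^ 2 + 12) ^ 3 <
      (C * (27 * B ^ 2) - ((n : ℝ) ^ 3 - 36 * (n : ℝ))) ^ 2 := by
    have hcube : ((n : ℝ) ^ 2 + 12) ^ 3 =
        (((n : ℝ) ^ 2 + 12) * Real.sqrt ((n : ℝ) ^ 2 + 12)) ^ 2 := by
      rw [mul_pow, hs]; ring
    rw [hcube, sq_lt_sq, abs_of_nonneg hs0, lt_abs]
    rcases h with h | h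
    · right
      have := (lt_div_iff₀ hB2).mp h
      linarith
    · left
      have := (div_lt_iff₀ hB2).mp h
      linarith
  have hC : C ≠ 0 := by
    rintro rfl
    nlinarith [sq_nonneg ((n : ℝ) ^ 2 - 4)]
  have hquad : 0 < 27 * B ^ 4 * C ^ 2 - 2 * B ^ 2 * C * (n : ℝ) * ((n : ℝ) ^ 2 - 36)
      - 4 * ((n : ℝ) ^ 2 - 4) ^ 2 := by
    linarith
  have hfac : Δ = C ^ 2 * (27 * B ^ 4 * C ^ 2 - 2 * B ^ 2 * C * (n : ℝ) * ((n : ℝ) ^ 2 - 36)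
      - 4 * ((n : ℝ) ^ 2 - 4) ^ 2) / (27648 * B ^ 2) := by
    simp only [Δ]
    ring
  rw [hfac]
  positivity
end

section
/- Let B > 0, let n ≥ 3 be a natural number, and let C be a real constant. Define p = (−(n²−4)² + 12nB²C)/(48B²), q = (−(n²−4)³ + 18n(n²−4)B²C − 54B⁴C²)/(864B³), Δ = p³/27 + q²/4, C₁ = (n³ − 36n − (n²+12)√(n²+12))/(27B²), and C₂ = (n³ − 36n + (n²+12)√(n²+12))/(27B²). If C₁ ≤ C ≤ C₂, then Δ ≤ 0 and p ≤ 0. -/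
/-- claim (ii) of Theorem 4.2. If C₁ ≤ C ≤ C₂, then the Cardano
discriminant Δ = p³/27 + q²/4 is nonpositive and p ≤ 0. -/
theorem eguchi_hanson_typeII_discriminant_nonpositive (B : ℝ) (hB : 0 < B)
    (n : ℕ) (hn : 3 ≤ n) (C : ℝ) :
    let p : ℝ := (-((n : ℝ) ^ 2 - 4) ^ 2 + 12 * (n : ℝ) * B ^ 2 * C) / (48 * B ^ 2)
    let q : ℝ := (-((n : ℝ) ^ 2 - 4) ^ 3
        + 18 * (n : ℝ) * ((n : ℝ) ^ 2 - 4) * B ^ 2 * C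
        - 54 * B ^ 4 * C ^ 2) / (864 * B ^ 3)
    let Δ : ℝ := p ^ 3 / 27 + q ^ 2 / 4
    let C₁ : ℝ := ((n : ℝ) ^ 3 - 36 * (n : ℝ)
        - ((n : ℝ) ^ 2 + 12) * Real.sqrt ((n : ℝ) ^ 2 + 12)) / (27 * B ^ 2)
    let C₂ : ℝ := ((n : ℝ) ^ 3 - 36 * (n : ℝ)
        + ((n : ℝ) ^ 2 + 12) * Real.sqrt ((n : ℝ) ^ 2 + 12)) / (27 * B ^ 2)
    C₁ ≤ C → C ≤ C₂ → Δ ≤ 0 ∧ p ≤ 0 := by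
  intro p q Δ C₁ C₂ h₁ h₂
  have hΔ : Δ ≤ 0 := by
    have hB2 : (0 : ℝ) < 27 * B ^ 2 := by positivity
    have h₁' := (div_le_iff₀ hB2).mp h₁
    have h₂' := (le_div_iff₀ hB2).mp h₂
    have hs : Real.sqrt ((n : ℝ) ^ 2 + 12) ^ 2 = (n : ℝ) ^ 2 + 12 :=
      Real.sq_sqrt (by positivity)
    have hΔ_eq : Δ = C ^ 2 *
        ((27 * B ^ 2 * C - ((n : ℝ) ^ 3 - 36 * n)) ^ 2 - ((n : ℝ) ^ 2 + 12) ^ 3)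
          / (746496 * B ^ 2) := by
      simp only [Δ, p, q]
      field_simp
      ring
    have hquad : (27 * B ^ 2 * C - ((n : ℝ) ^ 3 - 36 * n)) ^ 2 ≤ ((n : ℝ) ^ 2 + 12) ^ 3 := by
      calc _ ≤ (((n : ℝ) ^ 2 + 12) * Real.sqrt ((n : ℝ) ^ 2 + 12)) ^ 2 :=
            sq_le_sq' (by linarith) (by linarith)
        _ = _ := by rw [mul_pow, hs]; ring
    rw [hΔ_eq]
    exact div_nonpos_of_nonpos_of_nonneg
      (mul_nonpos_of_nonneg_of_nonpos (sq_nonneg C) (sub_nonpos.mpr hquad)) (by positivity)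
  refine ⟨hΔ, ?_⟩
  by_contra! hp
  have hΔ_pos : 0 < p ^ 3 / 27 + q ^ 2 / 4 := by positivity
  exact hΔ.not_gt hΔ_pos
end

section
/- Let B > 0 and let n ≥ 3 be a natural number. Define C₁ = (n³ − 36n − (n²+12)√(n²+12))/(27B²), C₂ = (n³ − 36n + (n²+12)√(n²+12))/(27B²), C₃ = ((n²−4)(3n − √(3n²+24)))/(18B²), and C₄ = ((n²−4)(3n + √(3n²+24)))/(18B²). Then C₁ < C₃ < C₂ < C₄. -/
/-- An upper bound for `(x² + 12) √(x² + 12)`, from `√(x² + 12) ≤ x + 6 / x`. -/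
theorem mul_sqrt_le {x s : ℝ} (hx : 3 ≤ x) (hs2 : s ^ 2 = x ^ 2 + 12) :
    (x ^ 2 + 12) * s ≤ x ^ 3 + 18 * x + 72 / x := by
  have hx0 : 0 < x := by linarith
  have hle : s ≤ x + 6 / x := by
    refine abs_le_of_sq_le_sq' ?_ (by positivity) |>.2
    have : (x + 6 / x) ^ 2 = x ^ 2 + 12 + (6 / x) ^ 2 := by field_simp; ring
    rw [this, hs2]
    linarith [sq_nonneg (6 / x)]
  calc (x ^ 2 + 12) * s ≤ (x ^ 2 + 12) * (x + 6 / x) := by gcongr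
    _ = x ^ 3 + 18 * x + 72 / x := by field_simp; ring

/-- The cube of `√(x² + 12)` exceeds `x³` by less than `12 √(3 x² + 24)`. -/
theorem cube_sub_lt {x s t : ℝ} (hx : 3 ≤ x) (hs2 : s ^ 2 = x ^ 2 + 12)
    (ht : 0 ≤ t) (ht2 : t ^ 2 = 3 * x ^ 2 + 24) :
    (x ^ 2 + 12) * s - x ^ 3 < 12 * t := by
  have hx0 : 0 < x := by linarith
  have hlt : 18 * x + 72 / x < 12 * t := by
    refine abs_lt_of_sq_lt_sq' ?_ (by positivity) |>.2
    have h1 : (18 * x + 72 / x) ^ 2 = 324 * x ^ 2 + 2592 + (72 / x) ^ 2 := by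
      field_simp; ring
    have h2 : 72 / x ≤ 24 := by rw [div_le_iff₀ hx0]; linarith
    have h3 : (72 / x) ^ 2 ≤ 24 ^ 2 := by gcongr
    nlinarith
  linarith [mul_sqrt_le hx hs2]

/-- The ordering of the numerators over a common denominator, for real `x ≥ 3`. -/
theorem numerators_ordering {x s t : ℝ} (hx : 3 ≤ x) (hs : 0 ≤ s) (hs2 : s ^ 2 = x ^ 2 + 12)
    (ht : 0 ≤ t) (ht2 : t ^ 2 = 3 * x ^ 2 + 24) :
    2 * (x ^ 3 - 36 * x - (x ^ 2 + 12) * s) < 3 * ((x ^ 2 - 4) * (3 * x - t)) ∧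
    3 * ((x ^ 2 - 4) * (3 * x - t)) < 2 * (x ^ 3 - 36 * x + (x ^ 2 + 12) * s) ∧
    2 * (x ^ 3 - 36 * x + (x ^ 2 + 12) * s) < 3 * ((x ^ 2 - 4) * (3 * x + t)) := by
  have hx0 : 0 < x := by linarith
  have ha : 0 < x ^ 2 - 4 := by nlinarith
  have hxs : x ≤ s := abs_le_of_sq_le_sq' (by linarith) hs |>.2
  have htx : t < 3 * x := abs_lt_of_sq_lt_sq' (by nlinarith) (by positivity) |>.2
  have hcube : x ^ 3 ≤ (x ^ 2 + 12) * s := by nlinarith [sq_nonneg x]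
  refine ⟨?_, ?_, ?_⟩
  · have := mul_pos ha (sub_pos.2 htx)
    linarith
  · have hD : 0 < (x ^ 2 + 12) * s + 36 * x - x ^ 3 := by linarith
    have hE : 0 < 3 * x + t := by linarith
    have hP : x ^ 3 - 36 * x + (x ^ 2 + 12) * s
        = 108 * (x ^ 2 - 4) ^ 2 / ((x ^ 2 + 12) * s + 36 * x - x ^ 3) := by
      rw [eq_div_iff hD.ne']
      linear_combination (x ^ 2 + 12) ^ 2 * hs2
    have hQ : 3 * x - t = 6 * (x ^ 2 - 4) / (3 * x + t) := by
      rw [eq_div_iff hE.ne']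
      linear_combination -ht2
    calc 3 * ((x ^ 2 - 4) * (3 * x - t))
        = 216 * (x ^ 2 - 4) ^ 2 / (12 * (3 * x + t)) := by rw [hQ]; field_simp; ring
      _ < 216 * (x ^ 2 - 4) ^ 2 / ((x ^ 2 + 12) * s + 36 * x - x ^ 3) := by
        gcongr
        linarith [cube_sub_lt hx hs2 ht ht2]
      _ = 2 * (x ^ 3 - 36 * x + (x ^ 2 + 12) * s) := by rw [hP]; ring
  · have h1 := mul_sqrt_le hx hs2
    have h2 : 72 / x ≤ 24 := by rw [div_le_iff₀ hx0]; linarith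
    have h3 : 3 ^ 3 ≤ x ^ 3 := by gcongr
    have h4 := mul_nonneg ha.le ht
    nlinarith

/-- the ordering C₁ < C₃ < C₂ < C₄ asserted in the proof of
Theorem 4.2. -/
theorem eguchi_hanson_typeII_constants_ordering (B : ℝ) (hB : 0 < B)
    (n : ℕ) (hn : 3 ≤ n) :
    let C₁ : ℝ := ((n : ℝ) ^ 3 - 36 * (n : ℝ)
        - ((n : ℝ) ^ 2 + 12) * Real.sqrt ((n : ℝ) ^ 2 + 12)) / (27 * B ^ 2)
    let C₂ : ℝ := ((n : ℝ) ^ 3 - 36 * (n : ℝ)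
        + ((n : ℝ) ^ 2 + 12) * Real.sqrt ((n : ℝ) ^ 2 + 12)) / (27 * B ^ 2)
    let C₃ : ℝ := (((n : ℝ) ^ 2 - 4) * (3 * (n : ℝ)
        - Real.sqrt (3 * (n : ℝ) ^ 2 + 24))) / (18 * B ^ 2)
    let C₄ : ℝ := (((n : ℝ) ^ 2 - 4) * (3 * (n : ℝ)
        + Real.sqrt (3 * (n : ℝ) ^ 2 + 24))) / (18 * B ^ 2)
    C₁ < C₃ ∧ C₃ < C₂ ∧ C₂ < C₄ := by
  intro C₁ C₂ C₃ C₄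
  have hx : (3 : ℝ) ≤ n := by exact_mod_cast hn
  obtain ⟨h1, h2, h3⟩ := numerators_ordering hx
    (Real.sqrt_nonneg _) (Real.sq_sqrt (by positivity : (0 : ℝ) ≤ (n : ℝ) ^ 2 + 12))
    (Real.sqrt_nonneg _) (Real.sq_sqrt (by positivity : (0 : ℝ) ≤ 3 * (n : ℝ) ^ 2 + 24))
  have scale₂₇ (a : ℝ) : a / (27 * B ^ 2) = 2 * a / (54 * B ^ 2) := by field_simp; ring
  have scale₁₈ (a : ℝ) : a / (18 * B ^ 2) = 3 * a / (54 * B ^ 2) := by field_simp; ring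
  have hB2 : 0 < 54 * B ^ 2 := by positivity
  simp only [C₁, C₂, C₃, C₄, scale₂₇, scale₁₈]
  exact ⟨div_lt_div_of_pos_right h1 hB2, div_lt_div_of_pos_right h2 hB2,
    div_lt_div_of_pos_right h3 hB2⟩
end

section
/- Let B > 0, let n ≥ 3 be a natural number, and let C be a real constant with C < C₁ or C > C₄, where C₁ = (n³ − 36n − (n²+12)√(n²+12))/(27B²) and C₄ = ((n²−4)(3n + √(3n²+24)))/(18B²). Define p = (−(n²−4)² + 12nB²C)/(48B²), q = (−(n²−4)³ + 18n(n²−4)B²C − 54B⁴C²)/(864B³), and Δ = p³/27 + q²/4. Then Δ > 0, q < 0, and the number s₀ = (−q/2 + √Δ)^{1/3} + (−q/2 − √Δ)^{1/3} + (n²−4)/(12B) (real cube roots) satisfies s₀ > 0 and s₀³ + ((4−n²)/(4B))·s₀² + (nC/4)·s₀ − BC²/16 = 0. -/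
/-- The real cube root function on ℝ. -/
noncomputable def realCbrt (x : ℝ) : ℝ :=
  if 0 ≤ x then x ^ ((1 : ℝ) / 3) else -((-x) ^ ((1 : ℝ) / 3))

theorem realCbrt_pow_three (x : ℝ) : realCbrt x ^ 3 = x := by
  have rpow_cube {y : ℝ} (hy : 0 ≤ y) : (y ^ ((1 : ℝ) / 3)) ^ 3 = y := by
    rw [← Real.rpow_natCast, ← Real.rpow_mul hy]
    norm_num
  unfold realCbrt
  split_ifs with hx
  · exact rpow_cube hx
  · rw [Odd.neg_pow (by decide), rpow_cube (by linarith), neg_neg]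

/-- Cardano's formula for a depressed cubic with nonnegative discriminant term. -/
theorem cardano_depressed {p q : ℝ} (hD : 0 ≤ p ^ 3 / 27 + q ^ 2 / 4) :
    let t := realCbrt (-q / 2 + Real.sqrt (p ^ 3 / 27 + q ^ 2 / 4))
      + realCbrt (-q / 2 - Real.sqrt (p ^ 3 / 27 + q ^ 2 / 4))
    t ^ 3 + p * t + q = 0 := by
  intro t
  have hu := realCbrt_pow_three (-q / 2 + Real.sqrt (p ^ 3 / 27 + q ^ 2 / 4))
  have hv := realCbrt_pow_three (-q / 2 - Real.sqrt (p ^ 3 / 27 + q ^ 2 / 4))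
  have hs := Real.sq_sqrt hD
  simp only [t]
  set d := Real.sqrt (p ^ 3 / 27 + q ^ 2 / 4)
  set u := realCbrt (-q / 2 + d)
  set v := realCbrt (-q / 2 - d)
  have huv : u * v = -p / 3 := by
    have h3 : Odd 3 := by decide
    apply h3.strictMono_pow.injective
    simp only [mul_pow, hu, hv]
    linear_combination -hs
  linear_combination hu + hv + 3 * (u + v) * huv

theorem add_realCbrt_pos {x y : ℝ} (h : 0 < x + y) : 0 < realCbrt x + realCbrt y := by
  have h3 : Odd 3 := by decide
  have : (-realCbrt y) ^ 3 < realCbrt x ^ 3 := by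
    rw [h3.neg_pow, realCbrt_pow_three, realCbrt_pow_three]
    linarith
  linarith [h3.strictMono_pow.lt_iff_lt.mp this]

theorem quadratics_of_lt {n x : ℝ} (hn : 3 ≤ n)
    (hx : 27 * x < n ^ 3 - 36 * n - (n ^ 2 + 12) * Real.sqrt (n ^ 2 + 12)) :
    x < 0 ∧ 0 < 27 * x ^ 2 + (72 * n - 2 * n ^ 3) * x - 4 * (n ^ 2 - 4) ^ 2 ∧
      -(n ^ 2 - 4) ^ 3 + 18 * n * (n ^ 2 - 4) * x - 54 * x ^ 2 < 0 := by
  have hr := Real.sq_sqrt (show 0 ≤ n ^ 2 + 12 by positivity)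
  have hM : 0 ≤ (n ^ 2 + 12) * Real.sqrt (n ^ 2 + 12) := by positivity
  set r := Real.sqrt (n ^ 2 + 12)
  have ha : 0 < n ^ 2 - 4 := by nlinarith
  have hMsq : ((n ^ 2 + 12) * r) ^ 2 = (n ^ 3 - 36 * n) ^ 2 + 108 * (n ^ 2 - 4) ^ 2 := by
    linear_combination (n ^ 2 + 12) ^ 2 * hr
  have hk : n ^ 3 - 36 * n < (n ^ 2 + 12) * r := by
    apply lt_of_pow_lt_pow_left₀ 2 hM
    rw [hMsq]
    linarith [pow_pos ha 2]
  have hx0 : x < 0 := by linarith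
  have hlt : ((n ^ 2 + 12) * r) ^ 2 < (n ^ 3 - 36 * n - 27 * x) ^ 2 :=
    pow_lt_pow_left₀ (by linarith) hM two_ne_zero
  refine ⟨hx0, by linarith, ?_⟩
  have h1 : 18 * n * (n ^ 2 - 4) * x < 0 := mul_neg_of_pos_of_neg (by positivity) hx0
  linarith [pow_pos ha 3, sq_nonneg x]

theorem quadratics_of_gt {n x : ℝ} (hn : 3 ≤ n)
    (hx : (n ^ 2 - 4) * (3 * n + Real.sqrt (3 * n ^ 2 + 24)) < 18 * x) :
    0 < x ∧ 0 < 27 * x ^ 2 + (72 * n - 2 * n ^ 3) * x - 4 * (n ^ 2 - 4) ^ 2 ∧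
      -(n ^ 2 - 4) ^ 3 + 18 * n * (n ^ 2 - 4) * x - 54 * x ^ 2 < 0 := by
  have hr := Real.sq_sqrt (show 0 ≤ 3 * n ^ 2 + 24 by positivity)
  have hr0 := Real.sqrt_nonneg (3 * n ^ 2 + 24)
  set r := Real.sqrt (3 * n ^ 2 + 24)
  have ha : 0 < n ^ 2 - 4 := by nlinarith
  have har : 0 ≤ (n ^ 2 - 4) * r := by positivity
  have hxn : (n ^ 2 - 4) * n < 6 * x := by linarith
  have hx0 : 0 < x := by
    have : 0 < (n ^ 2 - 4) * n := by positivity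
    linarith
  refine ⟨hx0, ?_, ?_⟩
  · have h1 : 54 * n ≤ 27 * x + (72 * n - 2 * n ^ 3) := by
      have : 0 ≤ n ^ 3 := by positivity
      linarith
    have h2 : 54 * n * x ≤ (27 * x + (72 * n - 2 * n ^ 3)) * x :=
      mul_le_mul_of_nonneg_right h1 hx0.le
    have h3 : 9 * n * ((n ^ 2 - 4) * n) < 9 * n * (6 * x) :=
      mul_lt_mul_of_pos_left hxn (by positivity)
    have h4 : 0 ≤ (n ^ 2 - 4) * (5 * n ^ 2 + 16) := by positivity
    linarith
  · have hsq : ((n ^ 2 - 4) * r) ^ 2 < (18 * x - 3 * n * (n ^ 2 - 4)) ^ 2 :=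
      pow_lt_pow_left₀ (by linarith) har two_ne_zero
    have hsq' : ((n ^ 2 - 4) * r) ^ 2 = (n ^ 2 - 4) ^ 2 * (3 * n ^ 2 + 24) := by
      rw [mul_pow, hr]
    linarith

/-- case (i) of the existence argument in Theorem 4.2. If C < C₁
or C > C₄, then Δ > 0, q < 0, and Cardano's formula
s₀ = ∛(−q/2 + √Δ) + ∛(−q/2 − √Δ) + (n²−4)/(12B) gives a positive root of the
cubic s³ + ((4−n²)/(4B))s² + (nC/4)s − BC²/16. -/
theorem eguchi_hanson_typeII_cardano_root (B : ℝ) (hB : 0 < B)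
    (n : ℕ) (hn : 3 ≤ n) (C : ℝ)
    (hC : C < ((n : ℝ) ^ 3 - 36 * (n : ℝ)
          - ((n : ℝ) ^ 2 + 12) * Real.sqrt ((n : ℝ) ^ 2 + 12)) / (27 * B ^ 2)
        ∨ (((n : ℝ) ^ 2 - 4) * (3 * (n : ℝ)
          + Real.sqrt (3 * (n : ℝ) ^ 2 + 24))) / (18 * B ^ 2) < C) :
    let p : ℝ := (-((n : ℝ) ^ 2 - 4) ^ 2 + 12 * (n : ℝ) * B ^ 2 * C) / (48 * B ^ 2)
    let q : ℝ := (-((n : ℝ) ^ 2 - 4) ^ 3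
        + 18 * (n : ℝ) * ((n : ℝ) ^ 2 - 4) * B ^ 2 * C
        - 54 * B ^ 4 * C ^ 2) / (864 * B ^ 3)
    let Δ : ℝ := p ^ 3 / 27 + q ^ 2 / 4
    let s₀ : ℝ := realCbrt (-q / 2 + Real.sqrt Δ) + realCbrt (-q / 2 - Real.sqrt Δ)
        + ((n : ℝ) ^ 2 - 4) / (12 * B)
    0 < Δ ∧ q < 0 ∧ 0 < s₀ ∧
      s₀ ^ 3 + ((4 - (n : ℝ) ^ 2) / (4 * B)) * s₀ ^ 2
        + ((n : ℝ) * C / 4) * s₀ - B * C ^ 2 / 16 = 0 := by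
  have hn' : (3 : ℝ) ≤ n := by exact_mod_cast hn
  generalize (n : ℝ) = m at *
  intro p q Δ s₀
  have hquad : B ^ 2 * C ≠ 0 ∧
      0 < 27 * (B ^ 2 * C) ^ 2 + (72 * m - 2 * m ^ 3) * (B ^ 2 * C) - 4 * (m ^ 2 - 4) ^ 2 ∧
      -(m ^ 2 - 4) ^ 3 + 18 * m * (m ^ 2 - 4) * (B ^ 2 * C) - 54 * (B ^ 2 * C) ^ 2 < 0 := by
    rcases hC with hC | hC
    · rw [lt_div_iff₀ (by positivity)] at hC
      have h := quadratics_of_lt (x := B ^ 2 * C) hn' (by linarith)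
      exact ⟨h.1.ne, h.2⟩
    · rw [div_lt_iff₀ (by positivity)] at hC
      have h := quadratics_of_gt (x := B ^ 2 * C) hn' (by linarith)
      exact ⟨h.1.ne', h.2⟩
  obtain ⟨hx0, hdisc, hQ⟩ := hquad
  have hΔ : 0 < Δ := by
    have hΔ_eq : Δ = 108 * (B ^ 2 * C) ^ 2 * (27 * (B ^ 2 * C) ^ 2
        + (72 * m - 2 * m ^ 3) * (B ^ 2 * C) - 4 * (m ^ 2 - 4) ^ 2) / (2985984 * B ^ 6) := by
      simp only [Δ, p, q]
      field_simp
      ring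
    rw [hΔ_eq]
    positivity
  have hq : q < 0 := div_neg_of_neg_of_pos (by linarith) (by positivity)
  have ha : 0 < m ^ 2 - 4 := by nlinarith
  have hroot : (s₀ - (m ^ 2 - 4) / (12 * B)) ^ 3 + p * (s₀ - (m ^ 2 - 4) / (12 * B)) + q = 0 := by
    simpa only [s₀, add_sub_cancel_right] using cardano_depressed hΔ.le
  refine ⟨hΔ, hq, add_pos (add_realCbrt_pos (by linarith)) (by positivity), ?_⟩
  rw [← hroot]
  simp only [p, q]
  generalize s₀ = s
  field_simp
  ring
end

section
/- Let B > 0, let n ≥ 3 be a natural number, and let C be a real constant. Define p = (−(n²−4)² + 12nB²C)/(48B²) and q = (−(n²−4)³ + 18n(n²−4)B²C − 54B⁴C²)/(864B³), and suppose p < 0 and p³/27 + q²/4 ≤ 0. Let α = arccos(−3q√(−3p)/(2p²)) ∈ [0, π] and s₀ = (2√(−3p)/3)·cos(α/3) + (n²−4)/(12B). Then the arccos argument satisfies |−3q√(−3p)/(2p²)| ≤ 1, s₀ > 0, and s₀³ + ((4−n²)/(4B))·s₀² + (nC/4)·s₀ − BC²/16 = 0. -/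
/-- The argument of the arccosine in Viète's trigonometric formula has absolute value at most `1`
when the depressed cubic `t³ + pt + q` has `p < 0` and nonpositive Cardano discriminant. -/
theorem abs_viete_arccos_arg_le_one {p q : ℝ} (hp : p < 0) (hΔ : p ^ 3 / 27 + q ^ 2 / 4 ≤ 0) :
    |(-3 * q * Real.sqrt (-3 * p)) / (2 * p ^ 2)| ≤ 1 := by
  have hw : Real.sqrt (-3 * p) ^ 2 = -3 * p := Real.sq_sqrt (by linarith)
  have hp4 : 0 < (2 * p ^ 2) ^ 2 := by have := hp.ne; positivity
  rw [← sq_le_one_iff_abs_le_one, div_pow, div_le_one hp4, mul_pow, hw]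
  nlinarith [mul_nonneg_of_nonpos_of_nonpos hp.le hΔ]

/-- Viète's trigonometric formula gives a root of the depressed cubic `t³ + pt + q` when `p < 0`
and the Cardano discriminant is nonpositive. -/
theorem viete_trigonometric_root {p q : ℝ} (hp : p < 0) (hΔ : p ^ 3 / 27 + q ^ 2 / 4 ≤ 0) {t : ℝ}
    (ht : t = 2 * Real.sqrt (-3 * p) / 3 *
      Real.cos (Real.arccos (-3 * q * Real.sqrt (-3 * p) / (2 * p ^ 2)) / 3)) :
    t ^ 3 + p * t + q = 0 := by
  have hw : Real.sqrt (-3 * p) ^ 2 = -3 * p := Real.sq_sqrt (by linarith)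
  obtain ⟨hl, hu⟩ := abs_le.mp (abs_viete_arccos_arg_le_one hp hΔ)
  have hcos := Real.cos_three_mul
    (Real.arccos (-3 * q * Real.sqrt (-3 * p) / (2 * p ^ 2)) / 3)
  rw [mul_div_cancel₀ _ (three_ne_zero' ℝ), Real.cos_arccos hl hu,
    div_eq_iff (by have := hp.ne; positivity)] at hcos
  subst ht
  generalize Real.cos _ = c at *
  generalize Real.sqrt _ = w at *
  refine (mul_eq_zero.mp ?_).resolve_left hp.ne
  linear_combination (8 / 27 * p * w * c ^ 3 + q / 3) * hw + w / 9 * hcos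

/-- The cosine of a third of an arccosine is positive. -/
theorem cos_arccos_div_three_pos (x : ℝ) : 0 < Real.cos (Real.arccos x / 3) := by
  have h₀ := Real.arccos_nonneg x
  have h₁ := Real.arccos_le_pi x
  exact Real.cos_pos_of_mem_Ioo ⟨by linarith [Real.pi_pos], by linarith [Real.pi_pos]⟩


/-- case (ii) of the existence argument in Theorem 4.2. If p < 0
and p³/27 + q²/4 ≤ 0, then the trigonometric formula
s₀ = (2√(−3p)/3)·cos(α/3) + (n²−4)/(12B), α = arccos(−3q√(−3p)/(2p²)),
produces a positive root of the cubic s³ + ((4−n²)/(4B))s² + (nC/4)s − BC²/16. -/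
theorem eguchi_hanson_typeII_trigonometric_root (B : ℝ) (hB : 0 < B)
    (n : ℕ) (hn : 3 ≤ n) (C : ℝ)
    (hp : (-((n : ℝ) ^ 2 - 4) ^ 2 + 12 * (n : ℝ) * B ^ 2 * C) / (48 * B ^ 2) < 0)
    (hΔ : ((-((n : ℝ) ^ 2 - 4) ^ 2 + 12 * (n : ℝ) * B ^ 2 * C) / (48 * B ^ 2)) ^ 3 / 27
        + ((-((n : ℝ) ^ 2 - 4) ^ 3 + 18 * (n : ℝ) * ((n : ℝ) ^ 2 - 4) * B ^ 2 * C
            - 54 * B ^ 4 * C ^ 2) / (864 * B ^ 3)) ^ 2 / 4 ≤ 0) :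
    let p : ℝ := (-((n : ℝ) ^ 2 - 4) ^ 2 + 12 * (n : ℝ) * B ^ 2 * C) / (48 * B ^ 2)
    let q : ℝ := (-((n : ℝ) ^ 2 - 4) ^ 3
        + 18 * (n : ℝ) * ((n : ℝ) ^ 2 - 4) * B ^ 2 * C
        - 54 * B ^ 4 * C ^ 2) / (864 * B ^ 3)
    let α : ℝ := Real.arccos (-3 * q * Real.sqrt (-3 * p) / (2 * p ^ 2))
    let s₀ : ℝ := (2 * Real.sqrt (-3 * p) / 3) * Real.cos (α / 3)
        + ((n : ℝ) ^ 2 - 4) / (12 * B)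
    |(-3 * q * Real.sqrt (-3 * p)) / (2 * p ^ 2)| ≤ 1 ∧ 0 < s₀ ∧
      s₀ ^ 3 + ((4 - (n : ℝ) ^ 2) / (4 * B)) * s₀ ^ 2
        + ((n : ℝ) * C / 4) * s₀ - B * C ^ 2 / 16 = 0 := by
  intro p q α s₀
  have hn' : (3 : ℝ) ≤ n := by exact_mod_cast hn
  refine ⟨abs_viete_arccos_arg_le_one hp hΔ, ?_, ?_⟩
  · have hcos : 0 < Real.cos (α / 3) := cos_arccos_div_three_pos _
    have hN : 0 < (n : ℝ) ^ 2 - 4 := by nlinarith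
    positivity
  · have hroot : (2 * Real.sqrt (-3 * p) / 3 * Real.cos (α / 3)) ^ 3
        + p * (2 * Real.sqrt (-3 * p) / 3 * Real.cos (α / 3)) + q = 0 :=
      viete_trigonometric_root hp hΔ rfl
    simp only [s₀]
    generalize 2 * Real.sqrt (-3 * p) / 3 * Real.cos (α / 3) = t at hroot ⊢
    rw [← hroot]
    simp only [p, q]
    field_simp
    ring
end

section
/- Let B > 0 and A, C be real constants, and suppose r⁴ + C·√(1+Br²) + A > 0 for all sufficiently large r; on such r set F(r) = 1 + (C·√(1+Br²) + A)/r⁴ (so F = f²) and define 𝓔(r) = √(1+Br²)·((3·F(r)⁻¹ − F(r) − 2)/r − F'(r)) − √B·((F(r)⁻¹ − 1) − F(r)⁻¹·(F(r)⁻¹ + F(r) − 2)) and U(r) = √(1+Br²)/√B. Then lim_{r→∞} r³·𝓔(r)·U(r) = A·√B. -/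
open Filter

/-- The ratio `√(1 + B r²) / r` tends to `√B` at infinity. -/
lemma tendsto_sqrt_one_add_mul_sq_div_atTop {B : ℝ} (hB : 0 < B) :
    Tendsto (fun r : ℝ => Real.sqrt (1 + B * r ^ 2) / r) atTop (nhds (Real.sqrt B)) := by
  have ht : Tendsto (fun r : ℝ => r⁻¹) atTop (nhds 0) := tendsto_inv_atTop_zero
  have h : Tendsto (fun r : ℝ => Real.sqrt ((r⁻¹) ^ 2 + B)) atTop (nhds (Real.sqrt B)) := by
    simpa using ((ht.pow 2).add_const B).sqrt
  refine h.congr' ?_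
  filter_upwards [eventually_gt_atTop (0 : ℝ)] with r hr
  have h1 : (r⁻¹) ^ 2 + B = (1 + B * r ^ 2) / r ^ 2 := by field_simp
  rw [h1, Real.sqrt_div (by positivity), Real.sqrt_sq hr.le]

/-- The derivative of `F(r) = 1 + (C√(1+Br²) + A)/r⁴` at a positive radius. -/
lemma hasDerivAt_eguchi_hanson_typeII {B : ℝ} (A C : ℝ) (hB : 0 < B) {r : ℝ} (hr : 0 < r) :
    HasDerivAt (fun s : ℝ => 1 + (C * Real.sqrt (1 + B * s ^ 2) + A) / s ^ 4)
      (C * B / (Real.sqrt (1 + B * r ^ 2) * r ^ 3)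
        - 4 * (C * Real.sqrt (1 + B * r ^ 2) + A) / r ^ 5) r := by
  have hpos : 0 < 1 + B * r ^ 2 := by positivity
  have hw : 0 < Real.sqrt (1 + B * r ^ 2) := Real.sqrt_pos.2 hpos
  have h1 : HasDerivAt (fun s : ℝ => 1 + B * s ^ 2) (B * (2 * r)) r := by
    simpa using ((hasDerivAt_pow 2 r).const_mul B).const_add 1
  have h2 := ((((h1.sqrt hpos.ne').const_mul C).add_const A).div
    (hasDerivAt_pow 4 r) (by positivity)).const_add 1
  refine h2.congr_deriv ?_
  push_cast
  field_simp

/-- the energy computation of Theorem 5.1. With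
F(r) = 1 + (C√(1+Br²) + A)/r⁴, the mass integrand
𝓔(r) = √(1+Br²)·((3F⁻¹ − F − 2)/r − F') − √B·((F⁻¹ − 1) − F⁻¹·(F⁻¹ + F − 2))
times U(r) = √(1+Br²)/√B and r³ tends to A·√B as r → ∞. -/
theorem eguchi_hanson_typeII_energy (B A C : ℝ) (hB : 0 < B)
    (hpos : ∀ᶠ r : ℝ in atTop,
      0 < r ^ 4 + C * Real.sqrt (1 + B * r ^ 2) + A) :
    Tendsto (fun r : ℝ =>
        r ^ 3 *
          (Real.sqrt (1 + B * r ^ 2) *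
              ((3 * (1 + (C * Real.sqrt (1 + B * r ^ 2) + A) / r ^ 4)⁻¹
                  - (1 + (C * Real.sqrt (1 + B * r ^ 2) + A) / r ^ 4) - 2) / r
                - deriv (fun s : ℝ =>
                    1 + (C * Real.sqrt (1 + B * s ^ 2) + A) / s ^ 4) r)
            - Real.sqrt B *
              (((1 + (C * Real.sqrt (1 + B * r ^ 2) + A) / r ^ 4)⁻¹ - 1)
                - (1 + (C * Real.sqrt (1 + B * r ^ 2) + A) / r ^ 4)⁻¹ *
                  ((1 + (C * Real.sqrt (1 + B * r ^ 2) + A) / r ^ 4)⁻¹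
                    + (1 + (C * Real.sqrt (1 + B * r ^ 2) + A) / r ^ 4) - 2)))
          * (Real.sqrt (1 + B * r ^ 2) / Real.sqrt B))
      atTop (nhds (A * Real.sqrt B)) := by
  have hb : 0 < Real.sqrt B := Real.sqrt_pos.2 hB
  have hq := tendsto_sqrt_one_add_mul_sq_div_atTop hB
  have ht : Tendsto (fun r : ℝ => r⁻¹) atTop (nhds 0) := tendsto_inv_atTop_zero
  have he : Tendsto (fun r : ℝ =>
      C * (Real.sqrt (1 + B * r ^ 2) / r) * r⁻¹ + A * r⁻¹ ^ 2) atTop (nhds 0) := by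
    simpa using ((hq.const_mul C).mul ht).add ((ht.pow 2).const_mul A)
  have hF : Tendsto (fun r : ℝ => 1 + (C * Real.sqrt (1 + B * r ^ 2) + A) / r ^ 4)
      atTop (nhds 1) := by
    have h : Tendsto (fun r : ℝ => 1 + (C * (Real.sqrt (1 + B * r ^ 2) / r) * r⁻¹
        + A * r⁻¹ ^ 2) * r⁻¹ ^ 2) atTop (nhds 1) := by
      simpa using (he.mul (ht.pow 2)).const_add 1
    refine h.congr' ?_
    filter_upwards [eventually_gt_atTop (0 : ℝ)] with r hr
    field_simp
  have hG := hF.inv₀ one_ne_zero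
  have hlim := (((he.pow 2).mul ((((hG.const_mul 3).mul (hq.pow 2)).div_const (Real.sqrt B)).sub
    (hq.mul (hG.sub (hG.pow 2))))).add (hq.const_mul A)).add
    ((ht.const_mul C).mul ((hq.div (hq.add_const (Real.sqrt B)) (by positivity))))
  have hval : ∀ x : ℝ, (0 : ℝ) ^ 2 * x + A * Real.sqrt B
      + C * 0 * (Real.sqrt B / (Real.sqrt B + Real.sqrt B)) = A * Real.sqrt B := by
    intro x; ring
  rw [hval] at hlim
  refine hlim.congr' ?_
  filter_upwards [eventually_gt_atTop (0 : ℝ), hpos] with r hr hFr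
  rw [(hasDerivAt_eguchi_hanson_typeII A C hB hr).deriv]
  have hw : 0 < Real.sqrt (1 + B * r ^ 2) := Real.sqrt_pos.2 (by positivity)
  have hw2 : Real.sqrt (1 + B * r ^ 2) ^ 2 = 1 + B * r ^ 2 := Real.sq_sqrt (by positivity)
  have hb2 : Real.sqrt B ^ 2 = B := Real.sq_sqrt hB.le
  simp only [Pi.div_apply]
  generalize Real.sqrt (1 + B * r ^ 2) = w at *
  generalize Real.sqrt B = b at *
  subst hb2
  obtain ⟨ε, hε⟩ : ∃ ε, ε = (C * w + A) / r ^ 4 := ⟨_, rfl⟩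
  have hF0 : 1 + ε ≠ 0 := by
    have : 1 + ε = (r ^ 4 + C * w + A) / r ^ 4 := by rw [hε]; field_simp; ring
    rw [this]
    positivity
  have hA : A = ε * r ^ 4 - C * w := by rw [hε]; field_simp; ring
  rw [← hε]
  have hG1 : (1 + ε)⁻¹ = 1 - ε + ε ^ 2 * (1 + ε)⁻¹ := by field_simp; ring
  have hlast : C * r⁻¹ * (w / r / (w / r + b)) = C * w * (w - b * r) / r := by
    have : w / r + b ≠ 0 := by positivity
    have : w + r * b ≠ 0 := by positivity
    field_simp
    linear_combination (-C) * hw2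
  have h1 : 3 * (1 + ε)⁻¹ - (1 + ε) - 2 = -4 * ε + 3 * ε ^ 2 * (1 + ε)⁻¹ := by
    linear_combination 3 * hG1
  have h2 : (1 + ε)⁻¹ - 1 - (1 + ε)⁻¹ * ((1 + ε)⁻¹ + (1 + ε) - 2)
      = -ε + ε ^ 2 * ((1 + ε)⁻¹ - (1 + ε)⁻¹ ^ 2) := by
    linear_combination (1 - (1 + ε)⁻¹) * hG1
  have h3 : C * (w / r) * r⁻¹ + A * r⁻¹ ^ 2 = ε * r ^ 2 := by
    rw [hA]; field_simp; ring
  have h4 : 4 * (C * w + A) / r ^ 5 = 4 * ε / r := by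
    rw [hA]; field_simp; ring
  rw [hlast, h1, h2, h3, h4, hA]
  generalize (1 + ε)⁻¹ = G
  field_simp
  ring
end
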